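/- Let Δ be a Delzant polygon with vertices p₁, …, p_d labeled in clockwise order and ℓᵢ the SL₂(ℤ)-length of the edge from pᵢ to pᵢ₊₁ (indices cyclic). Then the toric packing density satisfies ρ_T(Δ) = max { ‖q‖² / (2·area(Δ)) : q a vertex (extreme point) of 𝒫̃_T(Δ) }, where 𝒫̃_T(Δ) = {(λ₁, …, λ_d) ∈ ℝᵈ : λᵢ ≥ 0 and λᵢ + λᵢ₊₁ ≤ ℓᵢ for all i (cyclically)}. -/

import Mathlib

open Matrix MeasureTheory Set

/-- Points of the plane. -/
abbrev Pt := Fin 2 → ℝ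

/-- The action of `SL₂(ℤ)` on `ℝ²` by matrix-vector multiplication. -/
noncomputable def sl2Apply (M : Matrix.SpecialLinearGroup (Fin 2) ℤ) (x : Pt) : Pt :=
  ((M : Matrix (Fin 2) (Fin 2) ℤ).map (Int.cast : ℤ → ℝ)).mulVec x

/-- The model triangle `B(λ) = {(x,y) : x ≥ 0, y ≥ 0, x + y < λ}`. -/
def modelTriangle (lam : ℝ) : Set Pt :=
  {x | 0 ≤ x 0 ∧ 0 ≤ x 1 ∧ x 0 + x 1 < lam}

/-- The area (Lebesgue measure) of a subset of the plane. -/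
noncomputable def area (S : Set Pt) : ℝ := (volume S).toReal

/-- `B ⊆ Δ` is an admissibly packed triangle at the point `p` of `SL₂(ℤ)`-size `lam`:
`B = M (B(lam)) + p` for some `M ∈ SL₂(ℤ)` and `B` coincides with `Δ`
in a neighborhood of `p`. -/
def IsPackedTriangle (Δ : Set Pt) (p : Pt) (lam : ℝ) (B : Set Pt) : Prop :=
  0 < lam ∧ B ⊆ Δ ∧
  (∃ M : Matrix.SpecialLinearGroup (Fin 2) ℤ,
      B = (fun x => sl2Apply M x + p) '' modelTriangle lam) ∧
  ∃ U : Set Pt, IsOpen U ∧ p ∈ U ∧ B ∩ U = Δ ∩ U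

/-- `P` is a (toric) packing of the convex polygon with vertices `V`, where the triangle
packed at the vertex `V i` has `SL₂(ℤ)`-size `sz i` (with `sz i = 0` if no triangle is
packed there): `P` is a union of pairwise disjoint admissibly packed triangles. -/
def IsPacking {k : ℕ} (V : Fin k → Pt) (sz : Fin k → ℝ) (P : Set Pt) : Prop :=
  ∃ tri : Fin k → Set Pt,
    P = (⋃ i, tri i) ∧
    (∀ i, (sz i = 0 ∧ tri i = ∅) ∨
       IsPackedTriangle (convexHull ℝ (Set.range V)) (V i) (sz i) (tri i)) ∧
    Pairwise (Function.onFun Disjoint tri)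

/-- The set of densities `area P / area Δ` of packings `P` of the polygon with
vertices `V`; the toric packing density `ρ_T` is its supremum. -/
def densitySet {k : ℕ} (V : Fin k → Pt) : Set ℝ :=
  {r : ℝ | ∃ sz P, IsPacking V sz P ∧ r = area P / area (convexHull ℝ (Set.range V))}

/-- The determinant of a pair of integer vectors in the plane. -/
def detZ (u v : Fin 2 → ℤ) : ℤ := u 0 * v 1 - u 1 * v 0

/-- `V, dir, len` describe a Delzant polygon with `k` vertices `V i`, listed in clockwise
order: the edge from `V i` to `V (i+1)` is directed along the primitive integer vector
`dir i` and has `SL₂(ℤ)`-length `len i`, and each vertex satisfies the Delzant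
condition `det (u₁, u₂) = ± 1`. -/
structure IsDelzantPolygon {k : ℕ} [NeZero k] (V : Fin k → Pt)
    (dir : Fin k → Fin 2 → ℤ) (len : Fin k → ℝ) : Prop where
  three_le : 3 ≤ k
  len_pos : ∀ i, 0 < len i
  primitive : ∀ i, Int.gcd (dir i 0) (dir i 1) = 1
  edge_eq : ∀ i j, V (i + 1) j - V i j = len i * (dir i j : ℝ)
  clockwise : ∀ i, detZ (dir i) (dir (i + 1)) < 0
  delzant : ∀ i, detZ (dir i) (dir (i + 1)) = 1 ∨ detZ (dir i) (dir (i + 1)) = -1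
  edges_boundary : ∀ i, segment ℝ (V i) (V (i + 1)) ⊆ frontier (convexHull ℝ (Set.range V))

/-! ### Plane determinants -/

/-- The determinant of a pair of real vectors in the plane. -/
def det2 (u v : Pt) : ℝ := u 0 * v 1 - u 1 * v 0

/-- An integer vector viewed as a point of the plane. -/
def toPt (u : Fin 2 → ℤ) : Pt := fun j => (u j : ℝ)

lemma det2_toPt (u v : Fin 2 → ℤ) : det2 (toPt u) (toPt v) = (detZ u v : ℝ) := by
  simp [det2, toPt, detZ]

lemma eq_of_det2_eq_zero {u v x : Pt} (huv : det2 u v ≠ 0) (hu : det2 u x = 0)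
    (hv : det2 v x = 0) : x = 0 := by
  simp only [det2] at *
  have h0 : (u 0 * v 1 - u 1 * v 0) * x 0 = 0 := by linear_combination v 0 * hu - u 0 * hv
  have h1 : (u 0 * v 1 - u 1 * v 0) * x 1 = 0 := by linear_combination v 1 * hu - u 1 * hv
  ext j
  fin_cases j
  · simpa [huv] using h0
  · simpa [huv] using h1

lemma det2_decomp {u v : Pt} (huv : det2 u v = -1) (x : Pt) :
    x = (-det2 v x) • (-u) + (-det2 u x) • v := by
  simp only [det2] at *
  ext j
  fin_cases j
  · simp; linear_combination x 0 * huv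
  · simp; linear_combination x 1 * huv

lemma continuous_neg_det2 (w p : Pt) : Continuous fun x : Pt => -det2 w (x - p) := by
  simp only [det2]; fun_prop

/-! ### Area of the triangles -/

lemma volume_modelTriangle (lam : ℝ) (h : 0 ≤ lam) :
    volume (modelTriangle lam) = ENNReal.ofReal (lam ^ 2 / 2) := by
  have hm : MeasurableSet {p : ℝ × ℝ | 0 ≤ p.1 ∧ 0 ≤ p.2 ∧ p.1 + p.2 < lam} := by
    measurability
  have e : modelTriangle lam = MeasurableEquiv.finTwoArrow ⁻¹'
      {p : ℝ × ℝ | 0 ≤ p.1 ∧ 0 ≤ p.2 ∧ p.1 + p.2 < lam} := by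
    ext x; simp [modelTriangle]
  rw [e, (volume_preserving_finTwoArrow ℝ).measure_preimage hm.nullMeasurableSet,
    Measure.volume_eq_prod, Measure.prod_apply hm]
  have hs : ∀ x : ℝ, volume (Prod.mk x ⁻¹' {p : ℝ × ℝ | 0 ≤ p.1 ∧ 0 ≤ p.2 ∧ p.1 + p.2 < lam})
      = (Ico 0 lam).indicator (fun x => ENNReal.ofReal (lam - x)) x := by
    intro x
    by_cases hx : x ∈ Ico 0 lam
    · rw [indicator_of_mem hx]
      have : (Prod.mk x ⁻¹' {p : ℝ × ℝ | 0 ≤ p.1 ∧ 0 ≤ p.2 ∧ p.1 + p.2 < lam})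
          = Ico 0 (lam - x) := by
        ext y; simp only [mem_preimage, mem_ofPred_eq, mem_Ico]
        exact ⟨fun h => ⟨h.2.1, by linarith⟩, fun h => ⟨hx.1, h.1, by linarith⟩⟩
      rw [this, Real.volume_Ico, sub_zero]
    · rw [indicator_of_notMem hx]
      have : (Prod.mk x ⁻¹' {p : ℝ × ℝ | 0 ≤ p.1 ∧ 0 ≤ p.2 ∧ p.1 + p.2 < lam}) = ∅ := by
        ext y; simp only [mem_preimage, mem_ofPred_eq, mem_empty_iff_false, iff_false]
        exact fun h => hx ⟨h.1, by linarith⟩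
      rw [this, measure_empty]
  simp_rw [hs]
  rw [lintegral_indicator measurableSet_Ico, ← ofReal_integral_eq_lintegral_ofReal]
  · congr 1
    rw [integral_Ico_eq_integral_Ioc, ← intervalIntegral.integral_of_le h]
    rw [intervalIntegral.integral_sub (by simp) (by simp)]
    simp; ring
  · exact (Continuous.integrableOn_Icc (by fun_prop)).mono_set Ico_subset_Icc_self
  · filter_upwards [ae_restrict_mem measurableSet_Ico] with x hx
    exact sub_nonneg.2 hx.2.le

lemma volume_image_sl2Apply (M : Matrix.SpecialLinearGroup (Fin 2) ℤ) (p : Pt) (S : Set Pt) :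
    volume ((fun x => sl2Apply M x + p) '' S) = volume S := by
  have e : (fun x => sl2Apply M x + p) '' S = (fun x => x + p) ''
      ((Matrix.toLin' ((M : Matrix (Fin 2) (Fin 2) ℤ).map (Int.cast : ℤ → ℝ))) '' S) := by
    rw [image_image]; rfl
  have hd : ((M : Matrix (Fin 2) (Fin 2) ℤ).map (Int.cast : ℤ → ℝ)).det = 1 := by
    have := congrArg (Int.cast : ℤ → ℝ) M.det_coe
    rw [Matrix.det_fin_two] at this ⊢
    simpa using this
  rw [e, image_add_right, measure_preimage_add_right, Measure.addHaar_image_linearMap]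
  simp [hd]

/-- The triangle with corner `p` spanned by `lam • (-u)` and `lam • v` (when `det2 u v = -1`),
described by inequalities. -/
def cornerTriangle (p u v : Pt) (lam : ℝ) : Set Pt :=
  {x | 0 ≤ -det2 v (x - p) ∧ 0 ≤ -det2 u (x - p) ∧ -det2 v (x - p) + -det2 u (x - p) < lam}

lemma measurableSet_cornerTriangle (p u v : Pt) (lam : ℝ) :
    MeasurableSet (cornerTriangle p u v lam) := by
  have h : ∀ w : Pt, Measurable fun x : Pt => -det2 w (x - p) :=
    fun w => (continuous_neg_det2 w p).measurable
  exact (measurableSet_le measurable_const (h v)).inter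
    ((measurableSet_le measurable_const (h u)).inter
      (measurableSet_lt ((h v).add (h u)) measurable_const))

lemma sl2Apply_eq (M : Matrix.SpecialLinearGroup (Fin 2) ℤ) (x : Pt) :
    sl2Apply M x = x 0 • toPt (fun j => M j 0) + x 1 • toPt (fun j => M j 1) := by
  ext j
  simp [sl2Apply, Matrix.mulVec, dotProduct, Fin.sum_univ_two, toPt, mul_comm]

lemma mem_cornerTriangle_iff {u v : Pt} (huv : det2 u v = -1) (p x : Pt) (lam : ℝ) :
    x ∈ cornerTriangle p u v lam ↔
      ∃ a b : ℝ, 0 ≤ a ∧ 0 ≤ b ∧ a + b < lam ∧ x = a • (-u) + b • v + p := by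
  constructor
  · rintro ⟨ha, hb, hl⟩
    exact ⟨_, _, ha, hb, hl, by rw [← det2_decomp huv, sub_add_cancel]⟩
  · rintro ⟨a, b, ha, hb, hl, rfl⟩
    have h1 : -det2 v (a • (-u) + b • v + p - p) = a := by
      simp only [det2] at *; simp; linear_combination -a * huv
    have h2 : -det2 u (a • (-u) + b • v + p - p) = b := by
      simp only [det2] at *; simp; linear_combination -b * huv
    exact ⟨by rwa [h1], by rwa [h2], by rwa [h1, h2]⟩

lemma image_modelTriangle {u v : Fin 2 → ℤ} (huv : det2 (toPt u) (toPt v) = -1)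
    (M : Matrix.SpecialLinearGroup (Fin 2) ℤ) (h0 : (fun j => M j 0) = -u)
    (h1 : (fun j => M j 1) = v) (p : Pt) (lam : ℝ) :
    (fun x => sl2Apply M x + p) '' modelTriangle lam
      = cornerTriangle p (toPt u) (toPt v) lam := by
  have hn : toPt (-u) = -toPt u := by ext j; simp [toPt]
  ext x
  rw [mem_cornerTriangle_iff huv]
  simp only [mem_image, sl2Apply_eq, h0, h1, hn]
  constructor
  · rintro ⟨y, ⟨h1, h2, h3⟩, rfl⟩
    exact ⟨_, _, h1, h2, h3, rfl⟩
  · rintro ⟨a, b, ha, hb, hl, rfl⟩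
    exact ⟨![a, b], ⟨by simpa, by simpa, by simpa⟩, by simp⟩

/-- The matrix in `SL₂(ℤ)` with columns `-u` and `v`. -/
lemma exists_cornerMatrix {u v : Fin 2 → ℤ} (huv : detZ u v = -1) :
    ∃ M : Matrix.SpecialLinearGroup (Fin 2) ℤ,
      (fun j => M j 0) = -u ∧ (fun j => M j 1) = v := by
  refine ⟨⟨!![-u 0, v 0; -u 1, v 1], ?_⟩, ?_, ?_⟩
  · rw [Matrix.det_fin_two]; simp [detZ] at *; linarith
  · ext j; fin_cases j <;> simp
  · ext j; fin_cases j <;> simp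

lemma volume_cornerTriangle {u v : Fin 2 → ℤ} (huv : detZ u v = -1) (p : Pt) {lam : ℝ}
    (h : 0 ≤ lam) :
    volume (cornerTriangle p (toPt u) (toPt v) lam) = ENNReal.ofReal (lam ^ 2 / 2) := by
  obtain ⟨M, h0, h1⟩ := exists_cornerMatrix huv
  rw [← image_modelTriangle (by rw [det2_toPt, huv]; simp) M h0 h1, volume_image_sl2Apply,
    volume_modelTriangle lam h]

lemma exists_add_smul_mem {U : Set Pt} {p : Pt} (hU : IsOpen U) (hp : p ∈ U) (w : Pt)
    {r : ℝ} (hr : 0 < r) : ∃ t : ℝ, 0 < t ∧ t < r ∧ p + t • w ∈ U := by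
  have hc : Continuous fun t : ℝ => p + t • w := by fun_prop
  have h1 : ∀ᶠ t in nhdsWithin (0 : ℝ) (Ioi 0), p + t • w ∈ U :=
    nhdsWithin_le_nhds (hc.continuousAt.eventually_mem (hU.mem_nhds (by simpa using hp)))
  obtain ⟨t, ht, ht', ht''⟩ := (h1.and (Ioo_mem_nhdsGT hr)).exists
  exact ⟨t, ht', ht'', ht⟩

/-- A packed triangle at a Delzant corner is the corner triangle of the same size. -/
lemma packedTriangle_eq {K : Set Pt} {p : Pt} {u v : Fin 2 → ℤ} (huv : detZ u v = -1)
    (hKu : ∀ x ∈ K, det2 (toPt u) (x - p) ≤ 0) (hKv : ∀ x ∈ K, det2 (toPt v) (x - p) ≤ 0)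
    {r : ℝ} (hr : 0 < r) (hru : ∀ t, 0 ≤ t → t < r → p + t • (-toPt u) ∈ K)
    (hrv : ∀ t, 0 ≤ t → t < r → p + t • toPt v ∈ K) {lam : ℝ} {B : Set Pt}
    (hB : IsPackedTriangle K p lam B) : B = cornerTriangle p (toPt u) (toPt v) lam := by
  obtain ⟨hlam, hBK, ⟨M, hM⟩, U, hU, hpU, hBU⟩ := hB
  set c₁ : Fin 2 → ℤ := fun j => M j 0 with hc₁
  set c₂ : Fin 2 → ℤ := fun j => M j 1 with hc₂
  have hdet : detZ c₁ c₂ = 1 := by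
    have := M.det_coe
    rw [Matrix.det_fin_two] at this
    simp only [detZ, hc₁, hc₂]; linarith
  have inK : ∀ y : Pt, y ∈ modelTriangle lam → p + sl2Apply M y ∈ K := fun y hy =>
    hBK (by rw [hM, add_comm]; exact ⟨y, hy, rfl⟩)
  have bound : ∀ (w c : Fin 2 → ℤ), (∀ x ∈ K, det2 (toPt w) (x - p) ≤ 0) →
      (∃ t : ℝ, 0 < t ∧ p + t • toPt c ∈ K) → detZ w c ≤ 0 := by
    rintro w c hw ⟨t, ht, hK⟩
    have := hw _ hK
    have e : det2 (toPt w) (p + t • toPt c - p) = t * (detZ w c : ℝ) := by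
      simp [det2, toPt, detZ]; ring
    rw [e] at this
    exact_mod_cast (nonpos_of_mul_nonpos_right this ht)
  have hc₁K : ∃ t : ℝ, 0 < t ∧ p + t • toPt c₁ ∈ K := by
    refine ⟨lam / 2, by positivity, ?_⟩
    have := inK ![lam / 2, 0] ⟨by simp; positivity, by simp, by simp; linarith⟩
    simpa [sl2Apply_eq] using this
  have hc₂K : ∃ t : ℝ, 0 < t ∧ p + t • toPt c₂ ∈ K := by
    refine ⟨lam / 2, by positivity, ?_⟩
    have := inK ![0, lam / 2] ⟨by simp, by simp; positivity, by simp; linarith⟩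
    simpa [sl2Apply_eq] using this
  have coords : ∀ w : Fin 2 → ℤ, (∀ t, 0 ≤ t → t < r → p + t • toPt w ∈ K) →
      0 ≤ detZ w c₂ ∧ 0 ≤ detZ c₁ w := by
    intro w hw
    obtain ⟨t, ht, htr, htU⟩ := exists_add_smul_mem hU hpU (toPt w) hr
    have hmem : p + t • toPt w ∈ B ∩ U := hBU ▸ ⟨hw t ht.le htr, htU⟩
    have hmem' := hmem.1
    rw [hM] at hmem'
    obtain ⟨y, ⟨hy0, hy1, -⟩, hy⟩ := hmem'
    have hy' : y 0 • toPt c₁ + y 1 • toPt c₂ = t • toPt w := by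
      rw [← sl2Apply_eq]
      simpa [add_comm] using hy
    have e0 := congrFun hy' 0
    have e1 := congrFun hy' 1
    simp only [toPt, Pi.add_apply, Pi.smul_apply, smul_eq_mul] at e0 e1
    have hdet' : (c₁ 0 : ℝ) * c₂ 1 - c₁ 1 * c₂ 0 = 1 := by exact_mod_cast hdet
    have k0 : t * (detZ w c₂ : ℝ) = y 0 := by
      simp only [detZ]; push_cast
      linear_combination (-(c₂ 1 : ℝ)) * e0 + (c₂ 0 : ℝ) * e1 + y 0 * hdet'
    have k1 : t * (detZ c₁ w : ℝ) = y 1 := by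
      simp only [detZ]; push_cast
      linear_combination (c₁ 1 : ℝ) * e0 - (c₁ 0 : ℝ) * e1 + y 1 * hdet'
    constructor
    · have := nonneg_of_mul_nonneg_right (k0 ▸ hy0) ht
      exact_mod_cast this
    · have := nonneg_of_mul_nonneg_right (k1 ▸ hy1) ht
      exact_mod_cast this
  have hneg : toPt (-u) = -toPt u := by ext j; simp [toPt]
  obtain ⟨a1, a2⟩ := coords (-u) (by rw [hneg]; exact hru)
  obtain ⟨a3, a4⟩ := coords v hrv
  have b1 := bound u c₁ hKu hc₁K
  have b2 := bound u c₂ hKu hc₂K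
  have b3 := bound v c₁ hKv hc₁K
  have b4 := bound v c₂ hKv hc₂K
  have z1 : detZ u c₁ = 0 := by
    simp only [detZ, Pi.neg_apply] at *; linarith
  have z2 : detZ v c₂ = 0 := by
    simp only [detZ, Pi.neg_apply] at *; linarith
  have hprod : detZ v c₁ * detZ u c₂ = 1 := by
    have : detZ v c₁ * detZ u c₂ - detZ u c₁ * detZ v c₂ = -(detZ u v * detZ c₁ c₂) := by
      simp only [detZ]; ring
    rw [z1, z2, huv, hdet] at this; linarith
  obtain ⟨o1, o2⟩ : detZ v c₁ = -1 ∧ detZ u c₂ = -1 := by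
    rcases Int.mul_eq_one_iff_eq_one_or_neg_one.1 hprod with h | h
    · omega
    · exact h
  have e₁ : c₁ = -u := by
    simp only [detZ] at *
    ext j; fin_cases j
    · simp; linear_combination c₁ 0 * huv - v 0 * z1 + u 0 * o1
    · simp; linear_combination c₁ 1 * huv - v 1 * z1 + u 1 * o1
  have e₂ : c₂ = v := by
    simp only [detZ] at *
    ext j; fin_cases j
    · simp; linear_combination c₂ 0 * huv - v 0 * o2 + u 0 * z2
    · simp; linear_combination c₂ 1 * huv - v 1 * o2 + u 1 * z2
  rw [hM, image_modelTriangle (by rw [det2_toPt, huv]; simp) M e₁ e₂]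

lemma isPackedTriangle_cornerTriangle {K : Set Pt} {p : Pt} {u v : Fin 2 → ℤ}
    (huv : detZ u v = -1) (hKu : ∀ x ∈ K, det2 (toPt u) (x - p) ≤ 0)
    (hKv : ∀ x ∈ K, det2 (toPt v) (x - p) ≤ 0) {lam : ℝ} (hlam : 0 < lam)
    (hsub : cornerTriangle p (toPt u) (toPt v) lam ⊆ K) :
    IsPackedTriangle K p lam (cornerTriangle p (toPt u) (toPt v) lam) := by
  obtain ⟨M, h0, h1⟩ := exists_cornerMatrix huv
  refine ⟨hlam, hsub, ⟨M, (image_modelTriangle (by rw [det2_toPt, huv]; simp) M h0 h1 _ _).symm⟩,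
    {x | -det2 (toPt v) (x - p) + -det2 (toPt u) (x - p) < lam}, ?_, ?_, ?_⟩
  · exact isOpen_lt ((continuous_neg_det2 _ _).add (continuous_neg_det2 _ _)) continuous_const
  · simpa [det2] using hlam
  · ext x
    refine ⟨fun h => ⟨hsub h.1, h.2⟩, fun h => ⟨⟨?_, ?_, h.2⟩, h.2⟩⟩
    · linarith [hKv x h.1]
    · linarith [hKu x h.1]

/-! ### Geometry of a Delzant polygon -/

namespace IsDelzantPolygon

lemma vertex_mem {k : ℕ} (V : Fin k → Pt) (i : Fin k) : V i ∈ convexHull ℝ (range V) :=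
  subset_convexHull ℝ _ (mem_range_self i)

variable {k : ℕ} [NeZero k] {V : Fin k → Pt} {dir : Fin k → Fin 2 → ℤ} {len : Fin k → ℝ}

lemma detZ_succ (h : IsDelzantPolygon V dir len) (i : Fin k) :
    detZ (dir i) (dir (i + 1)) = -1 := by
  rcases h.delzant i with h1 | h1
  · linarith [h.clockwise i]
  · exact h1

lemma detZ_pred (h : IsDelzantPolygon V dir len) (i : Fin k) :
    detZ (dir (i - 1)) (dir i) = -1 := by
  simpa using h.detZ_succ (i - 1)

lemma det2_succ (h : IsDelzantPolygon V dir len) (i : Fin k) :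
    det2 (toPt (dir i)) (toPt (dir (i + 1))) = -1 := by
  rw [det2_toPt, h.detZ_succ]; simp

lemma det2_pred (h : IsDelzantPolygon V dir len) (i : Fin k) :
    det2 (toPt (dir (i - 1))) (toPt (dir i)) = -1 := by
  rw [det2_toPt, h.detZ_pred]; simp

lemma vertex_succ (h : IsDelzantPolygon V dir len) (i : Fin k) :
    V (i + 1) = V i + len i • toPt (dir i) := by
  ext j
  have := h.edge_eq i j
  simp [toPt]; linarith

lemma vertex_pred (h : IsDelzantPolygon V dir len) (i : Fin k) :
    V i = V (i - 1) + len (i - 1) • toPt (dir (i - 1)) := by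
  simpa using h.vertex_succ (i - 1)

/-- Barycentric decomposition of a point with respect to three consecutive vertices. -/
lemma decomp (h : IsDelzantPolygon V dir len) (i : Fin k) (x : Pt) :
    x = V i + (-det2 (toPt (dir i)) (x - V i) / len (i - 1)) • (V (i - 1) - V i)
      + (-det2 (toPt (dir (i - 1))) (x - V i) / len i) • (V (i + 1) - V i) := by
  have h1 : V (i - 1) - V i = len (i - 1) • (-toPt (dir (i - 1))) := by
    conv_lhs => rw [h.vertex_pred i]
    simp
  have h2 : V (i + 1) - V i = len i • toPt (dir i) := by
    rw [h.vertex_succ i]; simp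
  rw [h1, h2, smul_smul, smul_smul, div_mul_cancel₀ _ (h.len_pos _).ne',
    div_mul_cancel₀ _ (h.len_pos _).ne', add_assoc, ← det2_decomp (h.det2_pred i)]
  simp

lemma combination_mem (i : Fin k) {s t : ℝ} (hs : 0 ≤ s) (ht : 0 ≤ t) (hst : s + t ≤ 1) :
    V i + s • (V (i - 1) - V i) + t • (V (i + 1) - V i) ∈ convexHull ℝ (range V) := by
  have e : V i + s • (V (i - 1) - V i) + t • (V (i + 1) - V i)
      = (1 - s - t) • V i + s • V (i - 1) + t • V (i + 1) := by module
  rw [e]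
  have := (convex_convexHull ℝ (range V)).sum_mem (t := Finset.univ)
    (w := ![1 - s - t, s, t]) (z := ![V i, V (i - 1), V (i + 1)])
    (by intro j _; fin_cases j <;> simp <;> linarith)
    (by simp [Fin.sum_univ_three]; ring)
    (by intro j _; fin_cases j <;> simp [vertex_mem])
  simpa [Fin.sum_univ_three] using this

lemma weights_lt_one {i : Fin k} {lam : ℝ} (hlam : 0 < lam)
    (h1 : lam ≤ len (i - 1)) (h2 : lam ≤ len i) {x : Pt}
    (hx : x ∈ cornerTriangle (V i) (toPt (dir (i - 1))) (toPt (dir i)) lam) :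
    -det2 (toPt (dir i)) (x - V i) / len (i - 1)
      + -det2 (toPt (dir (i - 1))) (x - V i) / len i < 1 := by
  obtain ⟨ha, hb, hl⟩ := hx
  calc _ ≤ -det2 (toPt (dir i)) (x - V i) / lam + -det2 (toPt (dir (i - 1))) (x - V i) / lam :=
        add_le_add (div_le_div_of_nonneg_left ha hlam h1) (div_le_div_of_nonneg_left hb hlam h2)
    _ < 1 := by rwa [← add_div, div_lt_one hlam]

lemma cornerTriangle_subset (h : IsDelzantPolygon V dir len) {i : Fin k} {lam : ℝ}
    (hlam : 0 < lam) (h1 : lam ≤ len (i - 1)) (h2 : lam ≤ len i) :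
    cornerTriangle (V i) (toPt (dir (i - 1))) (toPt (dir i)) lam ⊆ convexHull ℝ (range V) := by
  intro x hx
  rw [h.decomp i x]
  exact combination_mem i (div_nonneg hx.1 (h.len_pos _).le) (div_nonneg hx.2.1 (h.len_pos _).le)
    (weights_lt_one hlam h1 h2 hx).le

lemma add_smul_mem (h : IsDelzantPolygon V dir len) (i : Fin k) {t : ℝ} (ht : 0 ≤ t)
    (ht' : t ≤ len i) : V i + t • toPt (dir i) ∈ convexHull ℝ (range V) := by
  have := combination_mem (V := V) i le_rfl (div_nonneg ht (h.len_pos i).le)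
    (by rw [zero_add, div_le_one (h.len_pos i)]; exact ht')
  rw [h.vertex_succ i, add_sub_cancel_left, smul_smul,
    div_mul_cancel₀ _ (h.len_pos _).ne'] at this
  simpa using this

lemma sub_smul_mem (h : IsDelzantPolygon V dir len) (i : Fin k) {t : ℝ} (ht : 0 ≤ t)
    (ht' : t ≤ len (i - 1)) : V i + t • (-toPt (dir (i - 1))) ∈ convexHull ℝ (range V) := by
  have := h.add_smul_mem (i - 1) (t := len (i - 1) - t) (by linarith) (by linarith)
  convert this using 1
  conv_lhs => rw [h.vertex_pred i]
  module

lemma interior_nonempty (h : IsDelzantPolygon V dir len) :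
    (interior (convexHull ℝ (range V))).Nonempty := by
  set l := min (len (0 - 1)) (len 0) with hl
  have hl0 : 0 < l := lt_min (h.len_pos _) (h.len_pos _)
  have hd := h.det2_pred 0
  refine ⟨V 0 + (l / 3) • (-toPt (dir (0 - 1))) + (l / 3) • toPt (dir 0),
    mem_interior.2 ⟨{x | 0 < -det2 (toPt (dir 0)) (x - V 0) ∧
      0 < -det2 (toPt (dir (0 - 1))) (x - V 0) ∧
      -det2 (toPt (dir 0)) (x - V 0) + -det2 (toPt (dir (0 - 1))) (x - V 0) < l}, ?_, ?_, ?_⟩⟩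
  · exact fun x hx => h.cornerTriangle_subset hl0 (min_le_left _ _) (min_le_right _ _)
      ⟨hx.1.le, hx.2.1.le, hx.2.2⟩
  · have hc := fun w => continuous_neg_det2 w (V 0)
    exact (isOpen_lt continuous_const (hc _)).inter
      ((isOpen_lt continuous_const (hc _)).inter (isOpen_lt ((hc _).add (hc _)) continuous_const))
  · have e1 : -det2 (toPt (dir 0)) (V 0 + (l / 3) • (-toPt (dir (0 - 1)))
        + (l / 3) • toPt (dir 0) - V 0) = l / 3 := by
      simp only [det2] at hd ⊢
      simp only [Pi.add_apply, Pi.sub_apply, Pi.smul_apply, Pi.neg_apply, smul_eq_mul]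
      linear_combination -(l / 3) * hd
    have e2 : -det2 (toPt (dir (0 - 1))) (V 0 + (l / 3) • (-toPt (dir (0 - 1)))
        + (l / 3) • toPt (dir 0) - V 0) = l / 3 := by
      simp only [det2] at hd ⊢
      simp only [Pi.add_apply, Pi.sub_apply, Pi.smul_apply, Pi.neg_apply, smul_eq_mul]
      linear_combination -(l / 3) * hd
    refine ⟨?_, ?_, ?_⟩
    · rw [e1]; positivity
    · rw [e2]; positivity
    · rw [e1, e2]; linarith

/-- The polygon lies to the right of each of its directed edges. -/
lemma halfplane (h : IsDelzantPolygon V dir len) (i : Fin k) {x : Pt}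
    (hx : x ∈ convexHull ℝ (range V)) : det2 (toPt (dir i)) (x - V i) ≤ 0 := by
  set K := convexHull ℝ (range V) with hK
  have hKc : Convex ℝ K := convex_convexHull ℝ _
  have hmid : midpoint ℝ (V i) (V (i + 1)) ∈ frontier K :=
    h.edges_boundary i (midpoint_mem_segment _ _)
  obtain ⟨f, hf⟩ := geometric_hahn_banach_open_point hKc.interior isOpen_interior hmid.2
  set m := midpoint ℝ (V i) (V (i + 1)) with hm
  obtain ⟨y, hy⟩ := h.interior_nonempty
  have hfK : ∀ z ∈ K, f z ≤ f m := by
    intro z hz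
    have hz' : z ∈ closure (interior K) := by
      rw [hKc.closure_interior_eq_closure_of_nonempty_interior h.interior_nonempty]
      exact subset_closure hz
    exact closure_minimal (fun w hw => (hf w hw).le)
      (isClosed_le f.continuous continuous_const) hz'
  have hm2 : f m = (f (V i) + f (V (i + 1))) / 2 := by
    rw [hm, midpoint_eq_smul_add, map_smul, map_add, invOf_eq_inv, smul_eq_mul]; ring
  have hfi := hfK _ (vertex_mem V i)
  have hfi1 := hfK _ (vertex_mem V (i + 1))
  have hfi2 := hfK _ (vertex_mem V (i + 1 + 1))
  have hli := h.len_pos i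
  have hli1 := h.len_pos (i + 1)
  have f1 : f (V (i + 1)) = f (V i) + len i * f (toPt (dir i)) := by
    rw [h.vertex_succ i, map_add, map_smul, smul_eq_mul]
  have f2 : f (V (i + 1 + 1)) = f (V (i + 1)) + len (i + 1) * f (toPt (dir (i + 1))) := by
    rw [h.vertex_succ (i + 1), map_add, map_smul, smul_eq_mul]
  have f0 : f (toPt (dir i)) = 0 := by
    have : len i * f (toPt (dir i)) = 0 := by linarith
    exact (mul_eq_zero.1 this).resolve_left hli.ne'
  rw [f0, mul_zero, add_zero] at f1
  have fm : f m = f (V i) := by linarith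
  have hd := h.det2_succ i
  have hfx : ∀ z : Pt, f z = f (V i) - det2 (toPt (dir i)) (z - V i) * f (toPt (dir (i + 1))) := by
    intro z
    have := congrArg f (det2_decomp hd (z - V i))
    rw [map_add, map_smul, map_smul, map_neg, f0, map_sub, smul_eq_mul, smul_eq_mul] at this
    linarith
  have hneg : f (toPt (dir (i + 1))) < 0 := by
    have h1 : f (toPt (dir (i + 1))) ≤ 0 := by
      have : len (i + 1) * f (toPt (dir (i + 1))) ≤ 0 := by linarith
      exact nonpos_of_mul_nonpos_right this hli1
    refine lt_of_le_of_ne h1 fun h0 => ?_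
    have := hf y hy
    rw [hfx y, h0, fm] at this
    simp at this
  have := hfK x hx
  rw [hfx x, fm] at this
  by_contra! hc
  nlinarith [mul_neg_of_pos_of_neg hc hneg]

lemma halfplane_succ (h : IsDelzantPolygon V dir len) (i : Fin k) {x : Pt}
    (hx : x ∈ convexHull ℝ (range V)) : det2 (toPt (dir i)) (x - V (i + 1)) ≤ 0 := by
  have := h.halfplane i hx
  rw [h.vertex_succ i]
  convert this using 1
  simp [det2]; ring

lemma halfplane_pred (h : IsDelzantPolygon V dir len) (i : Fin k) {x : Pt}
    (hx : x ∈ convexHull ℝ (range V)) : det2 (toPt (dir (i - 1))) (x - V i) ≤ 0 := by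
  simpa using h.halfplane_succ (i - 1) hx

lemma le_len (h : IsDelzantPolygon V dir len) {i : Fin k} {t : ℝ}
    (hx : V i + t • toPt (dir i) ∈ convexHull ℝ (range V)) : t ≤ len i := by
  have := h.halfplane (i + 1) hx
  have hd := h.det2_succ i
  rw [h.vertex_succ i] at this
  simp only [det2, Pi.add_apply, Pi.sub_apply, Pi.smul_apply, smul_eq_mul] at this hd
  nlinarith

lemma le_len_pred (h : IsDelzantPolygon V dir len) {i : Fin k} {t : ℝ}
    (hx : V i + t • (-toPt (dir (i - 1))) ∈ convexHull ℝ (range V)) : t ≤ len (i - 1) := by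
  have := h.halfplane_pred (i - 1) hx
  have hd := h.det2_pred (i - 1)
  rw [h.vertex_pred i] at this
  simp only [det2, Pi.add_apply, Pi.sub_apply, Pi.smul_apply, Pi.neg_apply, smul_eq_mul] at this hd
  nlinarith

/-- The polygon determines the edge leaving a vertex. -/
lemma vertex_succ_eq (h : IsDelzantPolygon V dir len) {i j : Fin k} (hij : V i = V j) :
    V (i + 1) = V (j + 1) := by
  have key : ∀ {a b : Fin k}, V a = V b → ∀ c, (∀ x ∈ convexHull ℝ (range V),
      det2 (toPt (dir c)) (x - V a) ≤ 0) → detZ (dir c) (dir b) ≤ 0 := by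
    intro a b hab c hc
    have := hc _ (vertex_mem V (b + 1))
    rw [hab, h.vertex_succ b] at this
    have e : det2 (toPt (dir c)) (V b + len b • toPt (dir b) - V b)
        = len b * (detZ (dir c) (dir b) : ℝ) := by
      simp [det2, toPt, detZ]; ring
    rw [e] at this
    exact_mod_cast nonpos_of_mul_nonpos_right this (h.len_pos b)
  have k1 := key hij i fun x hx => h.halfplane i hx
  have k2 := key hij.symm j fun x hx => h.halfplane j hx
  have k3 := key hij (i - 1) fun x hx => h.halfplane_pred i hx
  have k4 := key hij.symm (j - 1) fun x hx => h.halfplane_pred j hx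
  have d3 := h.detZ_pred i
  have d4 := h.detZ_pred j
  have hz : detZ (dir i) (dir j) = 0 := by
    simp only [detZ] at *; linarith
  set α := detZ (dir (i - 1)) (dir j) with hα
  set β := detZ (dir (j - 1)) (dir i) with hβ
  have e1 : ∀ l, dir j l = -α * dir i l := by
    intro l
    simp only [detZ] at *
    fin_cases l
    · simp; linear_combination dir j 0 * d3 + dir i 0 * hα + dir (i - 1) 0 * hz
    · simp; linear_combination dir j 1 * d3 + dir i 1 * hα + dir (i - 1) 1 * hz
  have e2 : α * β = 1 := by
    have : detZ (dir (j - 1)) (dir j) = -α * β := by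
      simp only [hβ, detZ, e1]; ring
    rw [d4] at this; linarith
  have hα1 : α = -1 := by
    rcases Int.mul_eq_one_iff_eq_one_or_neg_one.1 e2 with h1 | h1 <;> omega
  have hdir : dir j = dir i := by
    ext l; rw [e1, hα1]; simp
  have hlen : len i = len j := by
    apply le_antisymm
    · apply h.le_len
      rw [← hij, hdir, ← h.vertex_succ i]
      exact vertex_mem V _
    · apply h.le_len
      rw [hij, ← hdir, ← h.vertex_succ j]
      exact vertex_mem V _
  rw [h.vertex_succ i, h.vertex_succ j, hij, hdir, hlen]

open Fin.CommRing in
lemma vertex_injective (h : IsDelzantPolygon V dir len) (h0 : ∀ i, i ≠ 0 → V 0 ≠ V i) :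
    Function.Injective V := by
  intro i j hij
  have hn : ∀ n : ℕ, V (i + (n : Fin k)) = V (j + (n : Fin k)) := by
    intro n
    induction n with
    | zero => simpa using hij
    | succ n ih => simpa [add_assoc] using h.vertex_succ_eq ih
  have := hn (-i).val
  rw [Fin.cast_val_eq_self] at this
  by_contra hne
  refine h0 (j + -i) (fun h' => hne ?_) (by simpa using this)
  rw [← sub_eq_add_neg, sub_eq_zero] at h'
  exact h'.symm

/-- Each vertex other than `V i` lies beyond the chord joining the neighbours of `V i`. -/
lemma one_le_weights (h : IsDelzantPolygon V dir len) (hV : Function.Injective V) {i j : Fin k}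
    (hij : j ≠ i) :
    1 ≤ -det2 (toPt (dir i)) (V j - V i) / len (i - 1)
      + -det2 (toPt (dir (i - 1))) (V j - V i) / len i := by
  by_contra! hlt
  set s := -det2 (toPt (dir i)) (V j - V i) / len (i - 1) with hs
  set t := -det2 (toPt (dir (i - 1))) (V j - V i) / len i with ht
  have hs0 : 0 ≤ s := div_nonneg (by linarith [h.halfplane i (vertex_mem V j)]) (h.len_pos _).le
  have ht0 : 0 ≤ t :=
    div_nonneg (by linarith [h.halfplane_pred i (vertex_mem V j)]) (h.len_pos _).le
  have hdec := h.decomp i (V j)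
  rw [← hs, ← ht] at hdec
  have zero : ∀ w : Pt, (∀ x ∈ convexHull ℝ (range V), det2 w (x - V j) ≤ 0) →
      det2 w (V i - V j) = 0 := by
    intro w hw
    have w0 := hw _ (vertex_mem V i)
    have w1 := hw _ (vertex_mem V (i - 1))
    have w2 := hw _ (vertex_mem V (i + 1))
    have e : (1 - s - t) * det2 w (V i - V j) + s * det2 w (V (i - 1) - V j)
        + t * det2 w (V (i + 1) - V j) = 0 := by
      have c0 := congrFun hdec 0
      have c1 := congrFun hdec 1
      simp only [det2, Pi.add_apply, Pi.sub_apply, Pi.smul_apply, smul_eq_mul] at c0 c1 ⊢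
      linear_combination w 1 * c0 - w 0 * c1
    nlinarith [mul_nonpos_of_nonneg_of_nonpos hs0 w1, mul_nonpos_of_nonneg_of_nonpos ht0 w2]
  have z := eq_of_det2_eq_zero (by rw [h.det2_pred j]; norm_num)
    (zero _ fun x hx => h.halfplane_pred j hx) (zero _ fun x hx => h.halfplane j hx)
  exact hij (hV (sub_eq_zero.1 z)).symm

lemma disjoint_of_not_adjacent (h : IsDelzantPolygon V dir len) (hV : Function.Injective V)
    {i j : Fin k} (h1 : j ≠ i) (h2 : j - 1 ≠ i) (h3 : j + 1 ≠ i) {a b : ℝ}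
    (ha : 0 < a) (ha1 : a ≤ len (i - 1)) (ha2 : a ≤ len i)
    (hb : 0 < b) (hb1 : b ≤ len (j - 1)) (hb2 : b ≤ len j) :
    Disjoint (cornerTriangle (V i) (toPt (dir (i - 1))) (toPt (dir i)) a)
      (cornerTriangle (V j) (toPt (dir (j - 1))) (toPt (dir j)) b) := by
  rw [Set.disjoint_left]
  intro x hxi hxj
  have hlt := weights_lt_one ha ha1 ha2 hxi
  have hlt' := weights_lt_one hb hb1 hb2 hxj
  have hdec := h.decomp j x
  have hs0 := div_nonneg hxj.1 (h.len_pos (j - 1)).le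
  have ht0 := div_nonneg hxj.2.1 (h.len_pos j).le
  set s := -det2 (toPt (dir j)) (x - V j) / len (j - 1)
  set t := -det2 (toPt (dir (j - 1))) (x - V j) / len j
  have w1 := h.one_le_weights hV h1
  have w2 := h.one_le_weights hV h2
  have w3 := h.one_le_weights hV h3
  have e : ∀ w : Pt, det2 w (x - V i) = (1 - s - t) * det2 w (V j - V i)
      + s * det2 w (V (j - 1) - V i) + t * det2 w (V (j + 1) - V i) := by
    intro w
    have c0 := congrFun hdec 0
    have c1 := congrFun hdec 1
    simp only [det2, Pi.add_apply, Pi.sub_apply, Pi.smul_apply, smul_eq_mul] at c0 c1 ⊢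
    linear_combination w 0 * c1 - w 1 * c0
  rw [e, e] at hlt
  have m1 := mul_le_mul_of_nonneg_left w1 (by linarith : 0 ≤ 1 - s - t)
  have m2 := mul_le_mul_of_nonneg_left w2 hs0
  have m3 := mul_le_mul_of_nonneg_left w3 ht0
  have : ∀ p q r p' q' r' l l' : ℝ, -((1 - s - t) * p + s * q + t * r) / l
      + -((1 - s - t) * p' + s * q' + t * r') / l' = (1 - s - t) * (-p / l + -p' / l')
        + s * (-q / l + -q' / l') + t * (-r / l + -r' / l') := by
    intros; ring
  rw [this] at hlt
  linarith

/-- Triangles of compatible sizes at adjacent vertices are disjoint; this uses integrality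
of the self-intersection number of the common edge. -/
lemma disjoint_of_adjacent (h : IsDelzantPolygon V dir len) {i : Fin k} {a b : ℝ}
    (ha : 0 < a) (ha1 : a ≤ len (i - 1)) (hb : 0 < b) (hb2 : b ≤ len (i + 1))
    (hab : a + b ≤ len i) :
    Disjoint (cornerTriangle (V i) (toPt (dir (i - 1))) (toPt (dir i)) a)
      (cornerTriangle (V (i + 1)) (toPt (dir i)) (toPt (dir (i + 1))) b) := by
  rw [Set.disjoint_left]
  rintro x ⟨x1, x2, x3⟩ ⟨y1, y2, y3⟩
  have ea := h.halfplane (i + 1) (h.sub_smul_mem i ha.le ha1)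
  have eb := h.halfplane_pred i (h.add_smul_mem (i + 1) hb.le hb2)
  have hp := h.det2_pred i
  have hs := h.det2_succ i
  have vs := h.vertex_succ i
  set c : ℤ := detZ (dir (i + 1)) (dir (i - 1)) with hc
  have hcR : det2 (toPt (dir (i + 1))) (toPt (dir (i - 1))) = (c : ℝ) := det2_toPt _ _
  have hy : -det2 (toPt (dir i)) (x - V (i + 1)) = -det2 (toPt (dir i)) (x - V i) := by
    rw [vs]; simp only [det2, Pi.add_apply, Pi.sub_apply, Pi.smul_apply, smul_eq_mul]; ring
  have hwidth : -det2 (toPt (dir (i - 1))) (x - V i) + -det2 (toPt (dir (i + 1))) (x - V (i + 1))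
      = len i + c * -det2 (toPt (dir i)) (x - V i) := by
    rw [vs]
    generalize toPt (dir (i - 1)) = u at *
    generalize toPt (dir (i + 1)) = w at *
    generalize toPt (dir i) = e at *
    simp only [det2, Pi.add_apply, Pi.sub_apply, Pi.smul_apply, smul_eq_mul] at hp hs hcR ⊢
    linear_combination (-(u 0 * (x 1 - V i 1) - u 1 * (x 0 - V i 0)) - len i) * hs
      - (w 0 * (x 1 - V i 1) - w 1 * (x 0 - V i 0)) * hp
      - (e 0 * (x 1 - V i 1) - e 1 * (x 0 - V i 0)) * hcR
  have hca : 0 ≤ len i + c * a := by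
    rw [vs] at ea
    simp only [det2, Pi.add_apply, Pi.sub_apply, Pi.smul_apply, Pi.neg_apply, smul_eq_mul]
      at hs hcR ea
    linear_combination ea - len i * hs + a * hcR
  have hcb : 0 ≤ len i + c * b := by
    rw [vs] at eb
    simp only [det2, Pi.add_apply, Pi.sub_apply, Pi.smul_apply, smul_eq_mul] at hp hcR eb
    linear_combination eb - len i * hp + b * hcR
  rw [hy] at y2 y3
  generalize -det2 (toPt (dir i)) (x - V i) = y at *
  generalize -det2 (toPt (dir (i - 1))) (x - V i) = p at *
  generalize -det2 (toPt (dir (i + 1))) (x - V (i + 1)) = q at *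
  rcases le_or_gt (-2) c with h2 | h2
  · have h2' : (-2 : ℝ) ≤ c := by exact_mod_cast h2
    nlinarith [mul_nonneg (by linarith : (0 : ℝ) ≤ c + 2) x1]
  · have h2' : (c : ℝ) ≤ -3 := by exact_mod_cast (by omega : c ≤ -3)
    rcases le_total a b with hle | hle
    · nlinarith [mul_nonneg (by linarith : (0 : ℝ) ≤ -c - 2) (by linarith : 0 ≤ a - y),
        mul_nonneg (by linarith : (0 : ℝ) ≤ -c - 1) (by linarith : 0 ≤ b - a)]
    · nlinarith [mul_nonneg (by linarith : (0 : ℝ) ≤ -c - 2) (by linarith : 0 ≤ b - y),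
        mul_nonneg (by linarith : (0 : ℝ) ≤ -c - 1) (by linarith : 0 ≤ a - b)]

/-- In a packing of a Delzant polygon, the triangle at a vertex is the corner triangle. -/
lemma packedTriangle_eq (h : IsDelzantPolygon V dir len) {i : Fin k} {lam : ℝ} {B : Set Pt}
    (hB : IsPackedTriangle (convexHull ℝ (range V)) (V i) lam B) :
    B = cornerTriangle (V i) (toPt (dir (i - 1))) (toPt (dir i)) lam :=
  _root_.packedTriangle_eq (h.detZ_pred i) (fun _ hx => h.halfplane_pred i hx)
    (fun _ hx => h.halfplane i hx) (r := min (len (i - 1)) (len i))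
    (lt_min (h.len_pos _) (h.len_pos _))
    (fun _ ht ht' => h.sub_smul_mem i ht (ht'.le.trans (min_le_left _ _)))
    (fun _ ht ht' => h.add_smul_mem i ht (ht'.le.trans (min_le_right _ _))) hB

lemma add_smul_mem_cornerTriangle (h : IsDelzantPolygon V dir len) (i : Fin k) {t lam : ℝ}
    (ht : 0 ≤ t) (htl : t < lam) :
    V i + t • toPt (dir i) ∈ cornerTriangle (V i) (toPt (dir (i - 1))) (toPt (dir i)) lam :=
  (mem_cornerTriangle_iff (h.det2_pred i) _ _ _).2
    ⟨0, t, le_rfl, ht, by simpa, by rw [zero_smul, zero_add, add_comm]⟩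

lemma sub_smul_mem_cornerTriangle (h : IsDelzantPolygon V dir len) (i : Fin k) {t lam : ℝ}
    (ht : 0 ≤ t) (htl : t < lam) :
    V i + t • (-toPt (dir (i - 1)))
      ∈ cornerTriangle (V i) (toPt (dir (i - 1))) (toPt (dir i)) lam :=
  (mem_cornerTriangle_iff (h.det2_pred i) _ _ _).2
    ⟨t, 0, ht, le_rfl, by simpa, by rw [zero_smul, add_zero, add_comm]⟩

lemma size_le (h : IsDelzantPolygon V dir len) {i : Fin k} {lam : ℝ} {B : Set Pt}
    (hB : IsPackedTriangle (convexHull ℝ (range V)) (V i) lam B) :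
    lam ≤ len (i - 1) ∧ lam ≤ len i := by
  have hsub := hB.2.1
  rw [h.packedTriangle_eq hB] at hsub
  constructor
  · refine le_of_forall_lt_imp_le_of_dense fun t ht => ?_
    rcases le_or_gt t 0 with h0 | h0
    · exact h0.trans (h.len_pos _).le
    · exact h.le_len_pred (hsub (h.sub_smul_mem_cornerTriangle i h0.le ht))
  · refine le_of_forall_lt_imp_le_of_dense fun t ht => ?_
    rcases le_or_gt t 0 with h0 | h0
    · exact h0.trans (h.len_pos _).le
    · exact h.le_len (hsub (h.add_smul_mem_cornerTriangle i h0.le ht))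

lemma ne_succ (h : IsDelzantPolygon V dir len) (i : Fin k) : i ≠ i + 1 := by
  intro h1
  have := h.detZ_succ i
  rw [← h1] at this
  simp [detZ, mul_comm] at this

/-- The sizes of the triangles in a packing lie in the packing polytope. -/
lemma sizes_mem (h : IsDelzantPolygon V dir len) {sz : Fin k → ℝ} {P : Set Pt}
    (hP : IsPacking V sz P) (i : Fin k) : 0 ≤ sz i ∧ sz i + sz (i + 1) ≤ len i := by
  obtain ⟨tri, -, htri, hdisj⟩ := hP
  have h0 : ∀ j, 0 ≤ sz j := fun j => (htri j).elim (fun hj => hj.1.ge) fun hj => hj.1.le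
  refine ⟨h0 i, ?_⟩
  rcases htri i with ⟨hi, -⟩ | hi
  · rw [hi, zero_add]
    rcases htri (i + 1) with ⟨hj, -⟩ | hj
    · rw [hj]; exact (h.len_pos i).le
    · simpa using (h.size_le hj).1
  · have li := (h.size_le hi).2
    rcases htri (i + 1) with ⟨hj, -⟩ | hj
    · rwa [hj, add_zero]
    · have lj := (h.size_le hj).1
      rw [add_sub_cancel_right] at lj
      by_contra! hlt
      have hd := hdisj (h.ne_succ i)
      rw [Function.onFun, h.packedTriangle_eq hi, h.packedTriangle_eq hj] at hd
      set t := (len i - sz (i + 1) + sz i) / 2 with ht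
      refine Set.disjoint_left.1 hd
        (h.add_smul_mem_cornerTriangle i (t := t) (by linarith [h0 i]) (by linarith)) ?_
      convert h.sub_smul_mem_cornerTriangle (i + 1) (t := len i - t)
        (lam := sz (i + 1)) (by linarith [h0 (i + 1)])
        (by linarith) using 1
      rw [h.vertex_succ i, add_sub_cancel_right]
      module

/-- The area covered by a packing is half the sum of the squares of the sizes. -/
lemma area_packing (h : IsDelzantPolygon V dir len) {sz : Fin k → ℝ} {P : Set Pt}
    (hP : IsPacking V sz P) : area P = (∑ i, sz i ^ 2) / 2 := by
  obtain ⟨tri, rfl, htri, hdisj⟩ := hP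
  have hm : ∀ i, MeasurableSet (tri i) := by
    intro i
    rcases htri i with ⟨-, hi⟩ | hi
    · rw [hi]; exact MeasurableSet.empty
    · rw [h.packedTriangle_eq hi]; exact measurableSet_cornerTriangle _ _ _ _
  have hv : ∀ i, volume (tri i) = ENNReal.ofReal (sz i ^ 2 / 2) := by
    intro i
    rcases htri i with ⟨h0, hi⟩ | hi
    · rw [hi, h0]; simp
    · rw [h.packedTriangle_eq hi, volume_cornerTriangle (h.detZ_pred i) _ hi.1.le]
  rw [area, measure_iUnion hdisj hm, tsum_fintype]
  simp_rw [hv]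
  rw [← ENNReal.ofReal_sum_of_nonneg fun i _ => by positivity,
    ENNReal.toReal_ofReal (Finset.sum_nonneg fun i _ => by positivity), Finset.sum_div]

/-- Every point of the packing polytope is the vector of sizes of a packing. -/
lemma exists_packing (h : IsDelzantPolygon V dir len) (hV : Function.Injective V)
    {q : Fin k → ℝ} (hq : ∀ i, 0 ≤ q i ∧ q i + q (i + 1) ≤ len i) : ∃ P, IsPacking V q P := by
  have hq1 : ∀ i, q i ≤ len (i - 1) := by
    intro i
    have h1 := hq (i - 1)
    rw [sub_add_cancel] at h1
    linarith
  have hq2 : ∀ i, q i ≤ len i := fun i => by linarith [(hq i).2, (hq (i + 1)).1]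
  let T : Fin k → Set Pt := fun i => cornerTriangle (V i) (toPt (dir (i - 1))) (toPt (dir i)) (q i)
  have hT0 : ∀ i, q i = 0 → T i = ∅ := by
    rintro i hi
    refine eq_empty_of_forall_notMem fun x hx => ?_
    obtain ⟨h1, h2, h3⟩ := hx
    linarith
  have hadj : ∀ i, Disjoint (T i) (T (i + 1)) := by
    intro i
    rcases (hq i).1.eq_or_lt' with h0 | h0
    · rw [hT0 i h0]; exact Set.empty_disjoint _
    rcases (hq (i + 1)).1.eq_or_lt' with h1 | h1
    · rw [hT0 _ h1]; exact Set.disjoint_empty _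
    have := h.disjoint_of_adjacent h0 (hq1 i) h1 (hq2 (i + 1)) (hq i).2
    simpa [T] using this
  refine ⟨_, T, rfl, fun i => ?_, fun i j hij => ?_⟩
  · rcases (hq i).1.eq_or_lt' with h0 | h0
    · exact Or.inl ⟨h0, hT0 i h0⟩
    · exact Or.inr (isPackedTriangle_cornerTriangle (h.detZ_pred i)
        (fun _ hx => h.halfplane_pred i hx) (fun _ hx => h.halfplane i hx) h0
        (h.cornerTriangle_subset h0 (hq1 i) (hq2 i)))
  · rw [Function.onFun]
    rcases (hq i).1.eq_or_lt' with h0 | h0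
    · rw [hT0 i h0]; exact Set.empty_disjoint _
    rcases (hq j).1.eq_or_lt' with h1 | h1
    · rw [hT0 j h1]; exact Set.disjoint_empty _
    by_cases e1 : j - 1 = i
    · have := hadj i
      rwa [← e1, sub_add_cancel, e1] at this
    by_cases e2 : j + 1 = i
    · have := hadj j
      rw [e2] at this
      exact this.symm
    exact h.disjoint_of_not_adjacent hV hij.symm e1 e2 h0 (hq1 i) (hq2 i) h1 (hq1 j) (hq2 j)

end IsDelzantPolygon

/-! ### Maximizing the squared norm over the packing polytope -/

lemma isCompact_packingPolytope {k : ℕ} [NeZero k] (len : Fin k → ℝ) :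
    IsCompact {l : Fin k → ℝ | ∀ i, 0 ≤ l i ∧ l i + l (i + 1) ≤ len i} := by
  refine (isCompact_univ_pi fun i => isCompact_Icc (a := 0) (b := len i)).of_isClosed_subset ?_ ?_
  · have : {l : Fin k → ℝ | ∀ i, 0 ≤ l i ∧ l i + l (i + 1) ≤ len i}
        = ⋂ i, {l | 0 ≤ l i} ∩ {l | l i + l (i + 1) ≤ len i} := by
      ext l; simp
    rw [this]
    exact isClosed_iInter fun i => (isClosed_le (by fun_prop) (by fun_prop)).inter
      (isClosed_le (by fun_prop) (by fun_prop))
  · exact fun l hl i _ => ⟨(hl i).1, by linarith [(hl i).2, (hl (i + 1)).1]⟩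

/-- A maximizer of the sum of squares over a set is an extreme point of that set. -/
lemma mem_extremePoints_of_sum_sq_max {ι : Type*} [Fintype ι] {S : Set (ι → ℝ)} {q : ι → ℝ}
    (hq : q ∈ S) (hmax : ∀ l ∈ S, ∑ i, l i ^ 2 ≤ ∑ i, q i ^ 2) : q ∈ S.extremePoints ℝ := by
  refine ⟨hq, fun x hx y hy hxy => ?_⟩
  obtain ⟨a, b, ha, hb, hab, rfl⟩ := hxy
  have e : ∑ i, (a • x + b • y) i ^ 2
      = a * ∑ i, x i ^ 2 + b * ∑ i, y i ^ 2 - a * b * ∑ i, (x i - y i) ^ 2 := by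
    simp only [Finset.mul_sum, ← Finset.sum_add_distrib, ← Finset.sum_sub_distrib]
    refine Finset.sum_congr rfl fun i _ => ?_
    obtain rfl : b = 1 - a := by linarith
    simp only [Pi.add_apply, Pi.smul_apply, smul_eq_mul]
    ring
  have hx' := mul_le_mul_of_nonneg_left (hmax x hx) ha.le
  have hy' := mul_le_mul_of_nonneg_left (hmax y hy) hb.le
  have hs : ∑ i, (x i - y i) ^ 2 = 0 := by
    refine le_antisymm ?_ (Finset.sum_nonneg fun i _ => sq_nonneg _)
    refine nonpos_of_mul_nonpos_right (a := a * b) ?_ (mul_pos ha hb)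
    have : a * ∑ i, (a • x + b • y) i ^ 2 + b * ∑ i, (a • x + b • y) i ^ 2
        = ∑ i, (a • x + b • y) i ^ 2 := by rw [← add_mul, hab, one_mul]
    linarith
  rw [Finset.sum_eq_zero_iff_of_nonneg fun i _ => sq_nonneg _] at hs
  obtain rfl : x = y := by
    ext i
    have := hs i (Finset.mem_univ i)
    exact sub_eq_zero.1 (pow_eq_zero_iff two_ne_zero |>.1 this)
  rw [← add_smul, hab, one_smul]

/-- The toric packing density of a Delzant polygon equals the maximum of
`‖q‖² / (2 · area Δ)` over the vertices (extreme points) of the polytope `𝒫̃_T(Δ)`. -/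
theorem stmt4 (d : ℕ) [NeZero d] (V : Fin d → Pt) (dir : Fin d → Fin 2 → ℤ)
    (len : Fin d → ℝ) (hΔ : IsDelzantPolygon V dir len)
    (hlex : ∀ i : Fin d, i ≠ 0 →
      V 0 0 < V i 0 ∨ (V 0 0 = V i 0 ∧ V 0 1 < V i 1)) :
    ∃ ρ : ℝ,
      IsGreatest {s : ℝ | ∃ q ∈ Set.extremePoints ℝ
          {l : Fin d → ℝ | ∀ i, 0 ≤ l i ∧ l i + l (i + 1) ≤ len i},
          s = (∑ i, q i ^ 2) / (2 * area (convexHull ℝ (Set.range V)))} ρ ∧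
      IsLUB (densitySet V) ρ := by
  have hV : Function.Injective V := hΔ.vertex_injective fun i hi h => by
    rcases hlex i hi with h1 | h1
    · exact h1.ne (congrFun h 0)
    · exact h1.2.ne (congrFun h 1)
  have hA : 0 ≤ 2 * area (convexHull ℝ (Set.range V)) :=
    mul_nonneg zero_le_two ENNReal.toReal_nonneg
  obtain ⟨q, hq, hmax⟩ := (isCompact_packingPolytope len).exists_isMaxOn
    ⟨0, fun i => by simpa using (hΔ.len_pos i).le⟩
    (by fun_prop : ContinuousOn (fun l : Fin d → ℝ => ∑ i, l i ^ 2) _)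
  refine ⟨_, ⟨⟨q, mem_extremePoints_of_sum_sq_max hq hmax, rfl⟩, ?_⟩, IsGreatest.isLUB ⟨?_, ?_⟩⟩
  · rintro s ⟨l, hl, rfl⟩
    exact div_le_div_of_nonneg_right (hmax hl.1) hA
  · obtain ⟨P, hP⟩ := hΔ.exists_packing hV hq
    exact ⟨q, P, hP, by rw [hΔ.area_packing hP, div_div]⟩
  · rintro r ⟨sz, P, hP, rfl⟩
    rw [hΔ.area_packing hP, div_div]
    exact div_le_div_of_nonneg_right (hmax (hΔ.sizes_mem hP)) hA
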